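/- Let t ∈ (0,1) and let L₀, L₁ ∈ UC₋. If the copolar of the Minkowski combination equals the intersection of the copolars, i.e. ((1−t)L₀ + tL₁)° = L₀° ∩ L₁°, then L₀ = L₁. -/

import Mathlib

open Set MeasureTheory Pointwise

noncomputable section

abbrev En (n : ℕ) := EuclideanSpace ℝ (Fin n)

/-- Standard inner product on ℝⁿ. -/
def dotp {n : ℕ} (x y : En n) : ℝ := ∑ i, x i * y i

/-- Closed positive orthant R̄₊ⁿ. -/
def posOrthantCl (n : ℕ) : Set (En n) := {x | ∀ i, 0 ≤ x i}
/-- Open positive orthant R₊ⁿ. -/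
def posOrthantOp (n : ℕ) : Set (En n) := {x | ∀ i, 0 < x i}
/-- Closed negative orthant R̄₋ⁿ. -/
def negOrthantCl (n : ℕ) : Set (En n) := {x | ∀ i, x i ≤ 0}
/-- Open negative orthant R₋ⁿ. -/
def negOrthantOp (n : ℕ) : Set (En n) := {x | ∀ i, x i < 0}

/-- Copolar A° = {x : ⟨x,y⟩ ≤ −1 for all y ∈ A}. -/
def copolar {n : ℕ} (A : Set (En n)) : Set (En n) := {x | ∀ y ∈ A, dotp x y ≤ -1}

/-- Membership in C₊: closed convex subset of R̄₊ⁿ with A + R₊ⁿ ⊆ A. -/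
def memCplus {n : ℕ} (A : Set (En n)) : Prop :=
  IsClosed A ∧ Convex ℝ A ∧ A ⊆ posOrthantCl n ∧ A + posOrthantOp n ⊆ A

/-- Membership in C₋: closed convex subset of R̄₋ⁿ with A + R₋ⁿ ⊆ A. -/
def memCminus {n : ℕ} (A : Set (En n)) : Prop :=
  IsClosed A ∧ Convex ℝ A ∧ A ⊆ negOrthantCl n ∧ A + negOrthantOp n ⊆ A

/-- Membership in CC₊: member of C₊ with bounded complement in R̄₊ⁿ. -/
def memCCplus {n : ℕ} (P : Set (En n)) : Prop :=
  memCplus P ∧ Bornology.IsBounded (posOrthantCl n \ P)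

/-- Membership in UC₋: nonempty member of C₋ contained in s* + R̄₋ⁿ for some s* ∈ R₋ⁿ. -/
def memUCminus {n : ℕ} (L : Set (En n)) : Prop :=
  L.Nonempty ∧ memCminus L ∧ ∃ s ∈ negOrthantOp n, L ⊆ s +ᵥ negOrthantCl n

/-- Support function of a set, with values in EReal. -/
def suppFn {n : ℕ} (A : Set (En n)) (x : En n) : EReal := ⨆ y ∈ A, ((dotp x y : ℝ) : EReal)

/-- Legendre transform of an EReal-valued function. -/
def legendre {n : ℕ} (f : En n → EReal) (y : En n) : EReal :=
  ⨆ x, ((dotp x y : ℝ) : EReal) - f x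
theorem dotp_eq_inner {n : ℕ} (x y : En n) : dotp x y = inner ℝ x y := by
  simp [dotp, PiLp.inner_apply, mul_comm]

/-- A functional bounded above on a nonempty set that is stable under adding the open negative
orthant has nonnegative coefficients. -/
theorem nonneg_of_dotp_le {n : ℕ} {x : En n} {L : Set (En n)} {u : ℝ} (hne : L.Nonempty)
    (hL : L + negOrthantOp n ⊆ L) (hu : ∀ y ∈ L, dotp x y ≤ u) (i : Fin n) : 0 ≤ x i := by
  obtain ⟨y, hy⟩ := hne
  by_contra! hi
  set k : ℝ := (|u - dotp x y + ∑ j, x j| + 1) / (-x i) with hk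
  have hk0 : 0 < k := div_pos (by positivity) (by linarith)
  have hkx : k * (-x i) = |u - dotp x y + ∑ j, x j| + 1 := div_mul_cancel₀ _ (by linarith)
  let v : En n := WithLp.toLp 2 fun j => -(if j = i then k else 0) - 1
  have hv : v ∈ negOrthantOp n := by
    intro j
    by_cases hj : j = i <;> simp [v, hj]
    linarith
  have hvu := hu _ (hL (Set.add_mem_add hy hv))
  have hdv : dotp x v = k * (-x i) - ∑ j, x j := by
    simp [dotp, v, mul_sub, Finset.sum_sub_distrib, mul_comm k]
  rw [dotp_eq_inner, inner_add_right, ← dotp_eq_inner, ← dotp_eq_inner, hdv, hkx] at hvu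
  linarith [le_abs_self (u - dotp x y + ∑ j, x j)]

/-- A nonzero nonnegative functional is bounded on a set of `memUCminus` by a negative number. -/
theorem exists_neg_bound_dotp {n : ℕ} {x : En n} {L : Set (En n)} (hL : memUCminus L)
    (hx : ∀ i, 0 ≤ x i) (hx0 : x ≠ 0) : ∃ m < 0, ∀ y ∈ L, dotp x y ≤ m := by
  obtain ⟨-, -, s, hs, hLs⟩ := hL
  obtain ⟨i, hi⟩ : ∃ i, x i ≠ 0 := by
    by_contra! h
    exact hx0 (PiLp.ext h)
  refine ⟨dotp x s, ?_, fun y hy => ?_⟩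
  · exact Finset.sum_neg' (fun j _ => mul_nonpos_of_nonneg_of_nonpos (hx j) (hs j).le)
      ⟨i, Finset.mem_univ i, mul_neg_of_pos_of_neg ((hx i).lt_of_ne' hi) (hs i)⟩
  · obtain ⟨z, hz, rfl⟩ := hLs hy
    refine Finset.sum_le_sum fun j _ => mul_le_mul_of_nonneg_left ?_ (hx j)
    simpa using hz j

/-- If the copolar of a Minkowski combination is contained in the copolar of the first set, then
the first set is contained in the second. -/
theorem subset_of_copolar_comb_subset {n : ℕ} {t : ℝ} (ht : t ∈ Set.Ioo (0 : ℝ) 1)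
    {L0 L1 : Set (En n)} (h0 : memUCminus L0) (h1 : memUCminus L1)
    (h : copolar ((1 - t) • L0 + t • L1) ⊆ copolar L0) : L0 ⊆ L1 := by
  intro y0 hy0
  by_contra hy1
  obtain ⟨f, u, hfL, hfy⟩ := geometric_hahn_banach_closed_point h1.2.1.2.1 h1.2.1.1 hy1
  set x : En n := (InnerProductSpace.toDual ℝ (En n)).symm f with hxf
  have hf : ∀ y, f y = dotp x y := fun y => by simp [dotp_eq_inner, hxf]
  simp only [hf] at hfL hfy
  have hx := nonneg_of_dotp_le h1.1 h1.2.1.2.2.2 fun y hy => (hfL y hy).le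
  have hx0 : x ≠ 0 := by
    intro hx0
    obtain ⟨y, hy⟩ := h1.1
    have := (hfL y hy).trans hfy
    simp [dotp_eq_inner, hx0] at this
  obtain ⟨m, hm, hbound⟩ := exists_neg_bound_dotp h0 hx hx0
  have hbdd : BddAbove (dotp x '' L0) := ⟨m, by rintro _ ⟨y, hy, rfl⟩; exact hbound y hy⟩
  have hneL : (dotp x '' L0).Nonempty := h0.1.image _
  set b := sSup (dotp x '' L0)
  have hble : ∀ y ∈ L0, dotp x y ≤ b := fun y hy => le_csSup hbdd ⟨y, hy, rfl⟩
  have hb0 : b < 0 := lt_of_le_of_lt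
    (csSup_le hneL (by rintro _ ⟨y, hy, rfl⟩; exact hbound y hy)) hm
  have hub : u < b := hfy.trans_le (hble y0 hy0)
  set c := (1 - t) * b + t * u with hc
  have hcb : c < b := by nlinarith [ht.1]
  have hc0 : 0 < -c := by linarith
  have hscale : ∀ y, dotp ((-c)⁻¹ • x) y ≤ -1 ↔ dotp x y ≤ c := by
    intro y
    rw [dotp_eq_inner, real_inner_smul_left, ← dotp_eq_inner, inv_mul_le_iff₀ hc0]
    simp
  have hmem : (-c)⁻¹ • x ∈ copolar ((1 - t) • L0 + t • L1) := by
    rintro _ ⟨_, ⟨p, hp, rfl⟩, _, ⟨q, hq, rfl⟩, rfl⟩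
    rw [hscale]
    simp only [dotp_eq_inner, inner_add_right, real_inner_smul_right]
    simp only [← dotp_eq_inner]
    exact add_le_add (mul_le_mul_of_nonneg_left (hble p hp) (by linarith [ht.2]))
      (mul_le_mul_of_nonneg_left (hfL q hq).le ht.1.le)
  have hbc : b ≤ c := csSup_le hneL (by
    rintro _ ⟨y, hy, rfl⟩
    exact (hscale y).1 (h hmem y hy))
  exact hbc.not_gt hcb

/-- For t ∈ (0,1) and L₀, L₁ ∈ UC₋, if ((1−t)L₀ + tL₁)° = L₀° ∩ L₁°,
then L₀ = L₁. -/
theorem eq_of_copolar_comb_eq_inter (n : ℕ) (hn : 1 ≤ n) (t : ℝ)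
    (ht : t ∈ Set.Ioo (0:ℝ) 1) (L0 L1 : Set (En n))
    (h0 : memUCminus L0) (h1 : memUCminus L1)
    (h : copolar ((1 - t) • L0 + t • L1) = copolar L0 ∩ copolar L1) :
    L0 = L1 := by
  refine (subset_of_copolar_comb_subset ht h0 h1 (h.trans_subset Set.inter_subset_left)).antisymm
    (subset_of_copolar_comb_subset (t := 1 - t) ⟨by linarith [ht.2], by linarith [ht.1]⟩ h1 h0 ?_)
  rw [sub_sub_cancel, add_comm, h]
  exact Set.inter_subset_right
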